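/- The following two statements are equivalent: (1) [Slope problem] For every n ≥ 3 and every set of n points in the real plane ℝ², not all collinear, the lines determined by pairs of these points have at least n − 1 distinct slopes (where slope is an element of ℝ ∪ {∞}). (2) Every full rank supersolvable line arrangement 𝒜 in ℙ²(ℝ) satisfies m(𝒜) ≥ (|𝒜| − 1)/2. -/

import Mathlib

open scoped Classical

/-- A point of the projective plane over `K`. -/
abbrev Pt (K : Type*) [Field K] := Projectivization K (Fin 3 → K)

/-- A (candidate) line arrangement: a finite set of linear subspaces of `K³`. -/
abbrev Arr (K : Type*) [Field K] := Finset (Submodule K (Fin 3 → K))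

/-- Every member of `A` is a projective line, i.e. a 2-dimensional linear subspace of `K³`. -/
def IsLineArr {K : Type*} [Field K] (A : Arr K) : Prop :=
  ∀ L ∈ A, Module.finrank K L = 2

/-- The multiplicity `m(P, A)`: the number of lines of `A` passing through `P`. -/
noncomputable def multAt {K : Type*} [Field K] (A : Arr K) (P : Pt K) : ℕ :=
  (A.filter fun L => P.submodule ≤ L).card

/-- `Sing(A)`: the set of points lying on at least two lines of `A`. -/
def SingSet {K : Type*} [Field K] (A : Arr K) : Set (Pt K) :=
  {P | 2 ≤ multAt A P}

/-- `Sing₂(A)`: the set of simple points, i.e. singular points of multiplicity exactly 2. -/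
def Sing2Set {K : Type*} [Field K] (A : Arr K) : Set (Pt K) :=
  {P | multAt A P = 2}

/-- `m(A)`: the maximum multiplicity of a singular point of `A`. -/
noncomputable def maxMult {K : Type*} [Field K] (A : Arr K) : ℕ :=
  sSup (multAt A '' SingSet A)

/-- `P` is a modular point of `A`: it is singular, and for every other singular point `Q`
the line through `P` and `Q` belongs to `A`. -/
def IsModular {K : Type*} [Field K] (A : Arr K) (P : Pt K) : Prop :=
  P ∈ SingSet A ∧ ∀ Q ∈ SingSet A, Q ≠ P → (P.submodule ⊔ Q.submodule) ∈ A

/-- `A` is supersolvable: it has a modular point. -/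
def Supersolvable {K : Type*} [Field K] (A : Arr K) : Prop :=
  ∃ P, IsModular A P

/-- `A` has full rank (rank 3): its lines have no common point. -/
def FullRank {K : Type*} [Field K] (A : Arr K) : Prop :=
  (⨅ L ∈ A, L) = ⊥

/-- The slope (an element of `ℝ ∪ {∞}`, with `∞ = none`) of the line through two points of
the real plane: `(y₂ − y₁)/(x₂ − x₁)` if `x₁ ≠ x₂`, and `∞` otherwise. -/
noncomputable def slopeOf (p q : ℝ × ℝ) : Option ℝ :=
  if p.1 = q.1 then none else some ((q.2 - p.2) / (q.1 - p.1))

section Duality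

/-- The homogeneous coordinates of a point of the affine plane. -/
def affineCoords (p : ℝ × ℝ) : Fin 3 → ℝ := ![p.1, p.2, 1]

/-- The homogeneous coordinates of the point at infinity of a given slope. -/
def slopeCoords : Option ℝ → Fin 3 → ℝ
  | none => ![0, 1, 0]
  | some s => ![1, s, 0]

/-- The line whose equation has coefficients `c` in the coordinates given by `e`. -/
noncomputable def dualLine (e : (Fin 3 → ℝ) ≃ₗ[ℝ] (Fin 3 → ℝ)) (c : Fin 3 → ℝ) :
    Submodule ℝ (Fin 3 → ℝ) :=
  LinearMap.ker (∑ i, c i • (LinearMap.proj i ∘ₗ e.toLinearMap) : (Fin 3 → ℝ) →ₗ[ℝ] ℝ)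

variable {e : (Fin 3 → ℝ) ≃ₗ[ℝ] (Fin 3 → ℝ)}

lemma mem_dualLine {c x : Fin 3 → ℝ} :
    x ∈ dualLine e c ↔ c 0 * e x 0 + c 1 * e x 1 + c 2 * e x 2 = 0 := by
  simp [dualLine, Fin.sum_univ_three]

lemma symm_mem_dualLine {c y : Fin 3 → ℝ} :
    e.symm y ∈ dualLine e c ↔ c 0 * y 0 + c 1 * y 1 + c 2 * y 2 = 0 := by
  simp [mem_dualLine]

lemma symm_mem_iff_of_dualLine_eq {c d : Fin 3 → ℝ} (h : dualLine e c = dualLine e d)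
    (y : Fin 3 → ℝ) :
    c 0 * y 0 + c 1 * y 1 + c 2 * y 2 = 0 ↔ d 0 * y 0 + d 1 * y 1 + d 2 * y 2 = 0 := by
  rw [← symm_mem_dualLine (e := e), h, symm_mem_dualLine]

lemma finrank_dualLine {c : Fin 3 → ℝ} (hc : c ≠ 0) : Module.finrank ℝ (dualLine e c) = 2 := by
  have hf : (∑ i, c i • (LinearMap.proj i ∘ₗ e.toLinearMap) : Module.Dual ℝ (Fin 3 → ℝ)) ≠ 0 := by
    intro h
    apply hc
    funext j
    simpa [Pi.single_apply] using congrArg (fun f => f (e.symm (Pi.single j 1))) h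
  have := Module.Dual.finrank_ker_add_one_of_ne_zero hf
  simp only [Module.finrank_fin_fun] at this
  exact Nat.succ_injective this

lemma affineCoords_ne_zero (p : ℝ × ℝ) : affineCoords p ≠ 0 := fun h => by
  simpa [affineCoords] using congrFun h 2

lemma slopeCoords_ne_zero (s : Option ℝ) : slopeCoords s ≠ 0 := fun h => by
  cases s with
  | none => simpa [slopeCoords] using congrFun h 1
  | some s => simpa [slopeCoords] using congrFun h 0

lemma slopeCoords_two (s : Option ℝ) : slopeCoords s 2 = 0 := by
  cases s <;> simp [slopeCoords]

lemma dualLine_affineCoords_injective :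
    Function.Injective fun p => dualLine e (affineCoords p) := by
  intro p q h
  have h₁ := symm_mem_iff_of_dualLine_eq h ![1, 0, -p.1]
  have h₂ := symm_mem_iff_of_dualLine_eq h ![0, 1, -p.2]
  simp [affineCoords] at h₁ h₂
  ext <;> linarith

lemma dualLine_slopeCoords_injective :
    Function.Injective fun s => dualLine e (slopeCoords s) := by
  intro s t h
  have h₁ := symm_mem_iff_of_dualLine_eq h ![1, 0, 0]
  cases s with
  | none => cases t <;> simp_all [slopeCoords]
  | some s =>
    have h₂ := symm_mem_iff_of_dualLine_eq h ![s, -1, 0]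
    cases t with
    | none => simp_all [slopeCoords]
    | some t =>
      simp [slopeCoords] at h₂
      rw [show s = t by linarith]

lemma dualLine_affineCoords_ne_slopeCoords (p : ℝ × ℝ) (s : Option ℝ) :
    dualLine e (affineCoords p) ≠ dualLine e (slopeCoords s) := fun h => by
  have := symm_mem_iff_of_dualLine_eq h ![0, 0, 1]
  simp [affineCoords, slopeCoords_two] at this

/-- Every line avoiding the point `e.symm (0, 0, 1)` is dual to a point of the affine plane. -/
lemma exists_dualLine_affineCoords_eq {L : Submodule ℝ (Fin 3 → ℝ)} {u : Fin 3 → ℝ}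
    (hu : e u = ![0, 0, 1]) (hL : Module.finrank ℝ L = 2) (huL : u ∉ L) :
    ∃ p, dualLine e (affineCoords p) = L := by
  obtain ⟨f, hfu, hLf⟩ := Submodule.exists_le_ker_of_notMem huL
  obtain ⟨c, hc⟩ : ∃ c : Fin 3 → ℝ, ∀ x, f x = c 0 * e x 0 + c 1 * e x 1 + c 2 * e x 2 := by
    refine ⟨fun i => f (e.symm fun j => if i = j then 1 else 0), fun x => ?_⟩
    have := LinearMap.pi_apply_eq_sum_univ (f ∘ₗ e.symm.toLinearMap) (e x)
    simp only [LinearMap.comp_apply, LinearEquiv.coe_coe, LinearEquiv.symm_apply_apply,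
      smul_eq_mul, Fin.sum_univ_three] at this
    rw [this]
    ring
  have hc₂ : c 2 ≠ 0 := by simpa [hc, hu] using hfu
  refine ⟨(c 0 / c 2, c 1 / c 2), (Submodule.eq_of_le_of_finrank_eq (fun x hx => ?_) ?_).symm⟩
  · have hx₀ : f x = 0 := hLf hx
    rw [hc] at hx₀
    simp only [mem_dualLine, affineCoords, Matrix.cons_val]
    field_simp
    linarith
  · rw [hL, finrank_dualLine (affineCoords_ne_zero _)]

/-- The displacement between two distinct points is proportional to their slope direction. -/
lemma exists_sub_eq_mul_slopeCoords {p q : ℝ × ℝ} (h : p ≠ q) :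
    ∃ t : ℝ, t ≠ 0 ∧ q.1 - p.1 = t * slopeCoords (slopeOf p q) 0 ∧
      q.2 - p.2 = t * slopeCoords (slopeOf p q) 1 := by
  unfold slopeOf
  split_ifs with h₁
  · refine ⟨q.2 - p.2, fun h₂ => h (Prod.ext h₁ (by linarith)), ?_, ?_⟩ <;>
      simp [slopeCoords, h₁]
  · have : q.1 - p.1 ≠ 0 := fun h₂ => h₁ (by linarith)
    refine ⟨q.1 - p.1, this, ?_, ?_⟩ <;> simp [slopeCoords]
    field_simp

/-- The point at infinity of slope `slopeOf p q` lies on the line through `p` and `q`. -/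
lemma slopeCoords_slopeOf_eq_zero_iff {p q : ℝ × ℝ} (h : p ≠ q) (y : Fin 3 → ℝ) :
    slopeCoords (slopeOf p q) 0 * y 0 + slopeCoords (slopeOf p q) 1 * y 1 +
        slopeCoords (slopeOf p q) 2 * y 2 = 0 ↔
      (q.1 - p.1) * y 0 + (q.2 - p.2) * y 1 = 0 := by
  obtain ⟨t, ht, h₁, h₂⟩ := exists_sub_eq_mul_slopeCoords h
  rw [h₁, h₂, slopeCoords_two, ← mul_right_inj' ht]
  ring_nf

lemma mem_dualLine_slopeOf {p q : ℝ × ℝ} (h : p ≠ q) {x : Fin 3 → ℝ}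
    (hp : x ∈ dualLine e (affineCoords p)) (hq : x ∈ dualLine e (affineCoords q)) :
    x ∈ dualLine e (slopeCoords (slopeOf p q)) := by
  rw [mem_dualLine] at *
  rw [slopeCoords_slopeOf_eq_zero_iff h]
  simp [affineCoords] at hp hq
  linarith

lemma collinear_iff_exists_equation (S : Set (ℝ × ℝ)) :
    Collinear ℝ S ↔ ∃ y : Fin 3 → ℝ, y ≠ 0 ∧ ∀ p ∈ S, p.1 * y 0 + p.2 * y 1 + y 2 = 0 := by
  rw [collinear_iff_exists_forall_eq_smul_vadd]
  constructor
  · rintro ⟨p₀, v, h⟩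
    by_cases hv : v = 0
    · refine ⟨![1, 0, -p₀.1], fun h => by simpa using congrFun h 0, fun p hp => ?_⟩
      obtain ⟨r, rfl⟩ := h p hp
      simp [hv]
    · refine ⟨![v.2, -v.1, p₀.2 * v.1 - p₀.1 * v.2], fun h => hv ?_, fun p hp => ?_⟩
      · have h₀ := congrFun h 0
        have h₁ := congrFun h 1
        simp at h₀ h₁
        exact Prod.ext h₁ h₀
      · obtain ⟨r, rfl⟩ := h p hp
        simp
        ring
  · rintro ⟨y, hy, h⟩
    by_cases h₁ : y 1 = 0
    · by_cases h₀ : y 0 = 0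
      · have hS : S = ∅ := by
          refine Set.eq_empty_of_forall_notMem fun p hp => hy ?_
          have := h p hp
          funext i
          fin_cases i <;> simp_all
        exact ⟨0, 0, by simp [hS]⟩
      · refine ⟨(-y 2 / y 0, 0), (0, 1), fun p hp => ⟨p.2, ?_⟩⟩
        have := h p hp
        ext
        · simp [h₁] at this ⊢
          field_simp
          linarith
        · simp
    · refine ⟨(0, -y 2 / y 1), (1, -y 0 / y 1), fun p hp => ⟨p.1, ?_⟩⟩
      have := h p hp
      ext
      · simp
      · simp
        field_simp
        linarith

end Duality

section Arrangements

lemma Projectivization.submodule_le_iff {K V : Type*} [Field K] [AddCommGroup V] [Module K V]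
    (P : Projectivization K V) (L : Submodule K V) : P.submodule ≤ L ↔ P.rep ∈ L := by
  rw [P.submodule_eq, Submodule.span_singleton_le_iff_mem]

lemma Projectivization.mk_submodule_le_iff {K V : Type*} [Field K] [AddCommGroup V] [Module K V]
    {v : V} (hv : v ≠ 0) (L : Submodule K V) : (mk K v hv).submodule ≤ L ↔ v ∈ L := by
  rw [submodule_mk, Submodule.span_singleton_le_iff_mem]

variable {K : Type*} [Field K]

/-- A line through two distinct points is their join. -/
lemma sup_submodule_eq_of_le {P Q : Pt K} (hPQ : Q ≠ P) {L : Submodule K (Fin 3 → K)}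
    (hL : Module.finrank K L = 2) (hP : P.submodule ≤ L) (hQ : Q.submodule ≤ L) :
    P.submodule ⊔ Q.submodule = L := by
  refine Submodule.eq_of_le_of_finrank_le (sup_le hP hQ) ?_
  have hlt : P.submodule < P.submodule ⊔ Q.submodule := by
    refine lt_of_le_of_ne le_sup_left fun h => hPQ ?_
    apply Projectivization.submodule_injective
    refine Submodule.eq_of_le_of_finrank_eq (h ▸ le_sup_right) ?_
    rw [P.finrank_submodule, Q.finrank_submodule]
  have := Submodule.finrank_lt_finrank_of_lt hlt
  rw [P.finrank_submodule] at this
  omega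

lemma multAt_le_maxMult {A : Arr K} {P : Pt K} (hP : P ∈ SingSet A) :
    multAt A P ≤ maxMult A := by
  refine le_csSup ⟨A.card, ?_⟩ ⟨P, hP, rfl⟩
  rintro _ ⟨Q, -, rfl⟩
  exact Finset.card_filter_le _ _

lemma maxMult_le {A : Arr K} {d : ℕ} (h : ∀ P, multAt A P ≤ d) : maxMult A ≤ d :=
  csSup_le' (by rintro _ ⟨Q, -, rfl⟩; exact h Q)

end Arrangements

section SupersolvableToSlopes

/-- The number of points of `S` on a line plus the number of slopes of `S` which are at infinity on
that line is at most the number of slopes, unless the line contains `S`. -/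
lemma card_filter_add_card_filter_slopes_le {S : Finset (ℝ × ℝ)}
    (hS : ¬ Collinear ℝ (S : Set (ℝ × ℝ))) {y : Fin 3 → ℝ} (hy : y ≠ 0) :
    (S.filter fun p => p.1 * y 0 + p.2 * y 1 + y 2 = 0).card +
      ((S.offDiag.image fun r => slopeOf r.1 r.2).filter fun s =>
        slopeCoords s 0 * y 0 + slopeCoords s 1 * y 1 + slopeCoords s 2 * y 2 = 0).card ≤
      (S.offDiag.image fun r => slopeOf r.1 r.2).card := by
  obtain ⟨p₀, hp₀, hne⟩ : ∃ p ∈ S, p.1 * y 0 + p.2 * y 1 + y 2 ≠ 0 := by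
    by_contra! h
    exact hS ((collinear_iff_exists_equation _).2 ⟨y, hy, h⟩)
  have hp₀_ne {p : ℝ × ℝ} (hp : p.1 * y 0 + p.2 * y 1 + y 2 = 0) : p₀ ≠ p := by
    rintro rfl
    exact hne hp
  set D := S.offDiag.image fun r => slopeOf r.1 r.2
  rw [← Finset.card_filter_add_card_filter_not (s := D) fun s =>
    slopeCoords s 0 * y 0 + slopeCoords s 1 * y 1 + slopeCoords s 2 * y 2 = 0, add_comm]
  refine Nat.add_le_add_left (Finset.card_le_card_of_injOn (slopeOf p₀) ?_ ?_) _
  · intro p hp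
    simp only [Finset.coe_filter, Set.mem_ofPred_eq] at hp ⊢
    refine ⟨Finset.mem_image.2 ⟨(p₀, p), by simp [hp₀, hp.1, hp₀_ne hp.2], rfl⟩, fun h => hne ?_⟩
    rw [slopeCoords_slopeOf_eq_zero_iff (hp₀_ne hp.2)] at h
    linarith [hp.2]
  · intro p hp q hq h
    simp only [Finset.coe_filter, Set.mem_ofPred_eq] at hp hq
    obtain ⟨t, -, h₁, h₂⟩ := exists_sub_eq_mul_slopeCoords (hp₀_ne hp.2)
    obtain ⟨r, -, h₃, h₄⟩ := exists_sub_eq_mul_slopeCoords (hp₀_ne hq.2)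
    rw [← h] at h₃ h₄
    generalize slopeCoords (slopeOf p₀ p) 0 = a at *
    generalize slopeCoords (slopeOf p₀ p) 1 = b at *
    have ht : t * (a * y 0 + b * y 1) ≠ 0 := fun h₅ => hne (by
      linear_combination hp.2 - y 0 * h₁ - y 1 * h₂ - h₅)
    have htr : t = r := mul_right_cancel₀ (right_ne_zero_of_mul ht) (by
      linear_combination hp.2 - hq.2 - y 0 * h₁ - y 1 * h₂ + y 0 * h₃ + y 1 * h₄)
    subst htr
    ext <;> linarith

/-- The line arrangement dual to a set of points together with its slopes. -/
noncomputable def slopeArr (S : Finset (ℝ × ℝ)) : Arr ℝ :=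
  (S.image fun p => dualLine (LinearEquiv.refl ℝ _) (affineCoords p)) ∪
    (S.offDiag.image fun r => slopeOf r.1 r.2).image fun s =>
      dualLine (LinearEquiv.refl ℝ _) (slopeCoords s)

lemma mem_slopeArr {S : Finset (ℝ × ℝ)} {L : Submodule ℝ (Fin 3 → ℝ)} :
    L ∈ slopeArr S ↔ (∃ p ∈ S, dualLine (LinearEquiv.refl ℝ _) (affineCoords p) = L) ∨
      ∃ s ∈ S.offDiag.image fun r => slopeOf r.1 r.2,
        dualLine (LinearEquiv.refl ℝ _) (slopeCoords s) = L := by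
  simp only [slopeArr, Finset.mem_union, Finset.mem_image]

lemma isLineArr_slopeArr (S : Finset (ℝ × ℝ)) : IsLineArr (slopeArr S) := by
  intro L hL
  obtain ⟨p, -, rfl⟩ | ⟨s, -, rfl⟩ := mem_slopeArr.1 hL
  · exact finrank_dualLine (affineCoords_ne_zero p)
  · exact finrank_dualLine (slopeCoords_ne_zero s)

lemma card_slopeArr (S : Finset (ℝ × ℝ)) :
    (slopeArr S).card = S.card + (S.offDiag.image fun r => slopeOf r.1 r.2).card := by
  rw [slopeArr, Finset.card_union_of_disjoint,
    Finset.card_image_of_injective _ dualLine_affineCoords_injective,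
    Finset.card_image_of_injective _ dualLine_slopeCoords_injective]
  rw [Finset.disjoint_left]
  rintro L hL hL'
  obtain ⟨p, -, rfl⟩ := Finset.mem_image.1 hL
  obtain ⟨s, -, h⟩ := Finset.mem_image.1 hL'
  exact dualLine_affineCoords_ne_slopeCoords p s h.symm

lemma fullRank_slopeArr {S : Finset (ℝ × ℝ)} (hS : ¬ Collinear ℝ (S : Set (ℝ × ℝ))) :
    FullRank (slopeArr S) := by
  refine (Submodule.eq_bot_iff _).2 fun y hy => ?_
  by_contra hy₀
  refine hS ((collinear_iff_exists_equation _).2 ⟨y, hy₀, fun p hp => ?_⟩)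
  have := iInf₂_le (f := fun L (_ : L ∈ slopeArr S) => L) _
    (mem_slopeArr.2 (Or.inl ⟨p, hp, rfl⟩)) hy
  simpa [mem_dualLine, affineCoords] using this

lemma multAt_slopeArr_le {S : Finset (ℝ × ℝ)} (hS : ¬ Collinear ℝ (S : Set (ℝ × ℝ))) (Q : Pt ℝ) :
    multAt (slopeArr S) Q ≤ (S.offDiag.image fun r => slopeOf r.1 r.2).card := by
  refine le_trans ?_ (card_filter_add_card_filter_slopes_le hS Q.rep_nonzero)
  refine le_trans (Finset.card_le_card (t := _ ∪ _) ?_) ((Finset.card_union_le _ _).trans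
    (Nat.add_le_add (Finset.card_image_le (f := fun p =>
      dualLine (LinearEquiv.refl ℝ _) (affineCoords p))) (Finset.card_image_le (f := fun s =>
      dualLine (LinearEquiv.refl ℝ _) (slopeCoords s)))))
  intro L hL
  rw [Finset.mem_filter, Q.submodule_le_iff, mem_slopeArr] at hL
  obtain ⟨⟨p, hp, rfl⟩ | ⟨s, hs, rfl⟩, hQ⟩ := hL <;> rw [mem_dualLine] at hQ
  · refine Finset.mem_union_left _ (Finset.mem_image_of_mem _ (Finset.mem_filter.2 ⟨hp, ?_⟩))
    simpa [affineCoords] using hQ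
  · exact Finset.mem_union_right _ (Finset.mem_image_of_mem _ (Finset.mem_filter.2 ⟨hs, hQ⟩))

lemma exists_equation_pair (p q : ℝ × ℝ) : ∃ y : Fin 3 → ℝ, y ≠ 0 ∧
    p.1 * y 0 + p.2 * y 1 + y 2 = 0 ∧ q.1 * y 0 + q.2 * y 1 + y 2 = 0 := by
  simpa using (collinear_iff_exists_equation _).1 (collinear_pair ℝ p q)

lemma supersolvable_slopeArr {S : Finset (ℝ × ℝ)} (hcard : 2 ≤ S.card)
    (hS : ¬ Collinear ℝ (S : Set (ℝ × ℝ))) : Supersolvable (slopeArr S) := by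
  have hv : (![0, 0, 1] : Fin 3 → ℝ) ≠ 0 := fun h => by simpa using congrFun h 2
  have hle (s : Option ℝ) : (Projectivization.mk ℝ _ hv).submodule ≤
      dualLine (LinearEquiv.refl ℝ _) (slopeCoords s) := by
    simp [mem_dualLine, slopeCoords_two]
  refine ⟨Projectivization.mk ℝ _ hv, ?_, fun Q hQ hne => ?_⟩
  · obtain ⟨p, hp, q, hq, hpq⟩ := Finset.one_lt_card.1 hcard
    obtain ⟨y, hy, hyp, hyq⟩ := exists_equation_pair p q
    have h₂ : 1 < (S.filter fun p => p.1 * y 0 + p.2 * y 1 + y 2 = 0).card :=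
      Finset.one_lt_card.2 ⟨p, by simp [*], q, by simp [*], hpq⟩
    have h₃ := card_filter_add_card_filter_slopes_le hS hy
    have h₄ : (S.offDiag.image fun r => slopeOf r.1 r.2).card ≤
        multAt (slopeArr S) (Projectivization.mk ℝ _ hv) := by
      refine Finset.card_le_card_of_injOn (fun s => dualLine (LinearEquiv.refl ℝ _) (slopeCoords s))
        (fun s hs => ?_) dualLine_slopeCoords_injective.injOn
      exact Finset.mem_filter.2 ⟨mem_slopeArr.2 (Or.inr ⟨s, hs, rfl⟩), hle s⟩
    change 2 ≤ multAt _ _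
    omega
  · suffices ∃ s ∈ S.offDiag.image fun r => slopeOf r.1 r.2,
        Q.submodule ≤ dualLine (LinearEquiv.refl ℝ _) (slopeCoords s) by
      obtain ⟨s, hs, hQs⟩ := this
      rw [sup_submodule_eq_of_le hne (finrank_dualLine (slopeCoords_ne_zero s)) (hle s) hQs]
      exact mem_slopeArr.2 (Or.inr ⟨s, hs, rfl⟩)
    obtain ⟨L, hL, M, hM, hLM⟩ := Finset.one_lt_card.1 hQ
    rw [Finset.mem_filter, mem_slopeArr] at hL hM
    obtain ⟨⟨p, hp, rfl⟩ | ⟨s, hs, rfl⟩, hQL⟩ := hL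
    · obtain ⟨⟨q, hq, rfl⟩ | ⟨s, hs, rfl⟩, hQM⟩ := hM
      · have hpq : p ≠ q := fun h => hLM (h ▸ rfl)
        refine ⟨slopeOf p q, Finset.mem_image.2 ⟨(p, q), by simp [*], rfl⟩, ?_⟩
        rw [Q.submodule_le_iff] at *
        exact mem_dualLine_slopeOf hpq hQL hQM
      · exact ⟨s, hs, hQM⟩
    · exact ⟨s, hs, hQL⟩

end SupersolvableToSlopes

section SlopesToSupersolvable

variable {e : (Fin 3 → ℝ) ≃ₗ[ℝ] (Fin 3 → ℝ)} {A : Arr ℝ} {P : Pt ℝ}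

/-- The slope of two points dual to lines of `A` is dual to a line of `A` through a modular
point. -/
lemma dualLine_slopeOf_mem_of_isModular (hP : IsModular A P) (he : e P.rep = ![0, 0, 1])
    {p q : ℝ × ℝ} (hpq : p ≠ q) (hp : dualLine e (affineCoords p) ∈ A)
    (hq : dualLine e (affineCoords q) ∈ A) :
    dualLine e (slopeCoords (slopeOf p q)) ∈ A.filter fun L => P.submodule ≤ L := by
  have hPs : P.submodule ≤ dualLine e (slopeCoords (slopeOf p q)) := by
    simp [P.submodule_le_iff, mem_dualLine, he, slopeCoords_two]
  obtain ⟨y, hy, hyp, hyq⟩ := exists_equation_pair p q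
  have hy' : e.symm y ≠ 0 := by simpa using hy
  have hQp : e.symm y ∈ dualLine e (affineCoords p) := by
    rw [symm_mem_dualLine]; simpa [affineCoords] using hyp
  have hQq : e.symm y ∈ dualLine e (affineCoords q) := by
    rw [symm_mem_dualLine]; simpa [affineCoords] using hyq
  have hsing : Projectivization.mk ℝ _ hy' ∈ SingSet A := by
    refine Finset.one_lt_card.2 ⟨_, Finset.mem_filter.2 ⟨hp, ?_⟩, _, Finset.mem_filter.2 ⟨hq, ?_⟩,
      dualLine_affineCoords_injective.ne hpq⟩ <;>
    rwa [Projectivization.mk_submodule_le_iff]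
  have hne : Projectivization.mk ℝ _ hy' ≠ P := by
    rintro rfl
    have : (Projectivization.mk ℝ _ hy').submodule ≤ dualLine e (affineCoords p) := by
      rwa [Projectivization.mk_submodule_le_iff]
    rw [Projectivization.submodule_le_iff, mem_dualLine, he] at this
    simp [affineCoords] at this
  refine Finset.mem_filter.2 ⟨?_, hPs⟩
  have hmem := hP.2 _ hsing hne
  rwa [sup_submodule_eq_of_le hne (finrank_dualLine (slopeCoords_ne_zero (slopeOf p q))) hPs]
    at hmem
  rw [Projectivization.mk_submodule_le_iff]
  exact mem_dualLine_slopeOf hpq hQp hQq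

/-- The lines of `A` avoiding the point `P` are dual to a finite set of points of the affine
plane. -/
lemma exists_image_dualLine_eq (hA : IsLineArr A) (he : e P.rep = ![0, 0, 1]) :
    ∃ S : Finset (ℝ × ℝ),
      (S.image fun p => dualLine e (affineCoords p)) = A.filter fun L => ¬ P.submodule ≤ L := by
  obtain ⟨S, -, hS⟩ := (Finset.subset_set_image_iff (s := Set.univ)
    (t := A.filter fun L => ¬ P.submodule ≤ L) (f := fun p => dualLine e (affineCoords p))).1 (by
      intro L hL
      obtain ⟨hLA, hPL⟩ := Finset.mem_filter.1 hL
      rw [P.submodule_le_iff] at hPL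
      obtain ⟨p, hp⟩ := exists_dualLine_affineCoords_eq he (hA L hLA) hPL
      exact ⟨p, trivial, hp⟩)
  exact ⟨S, hS⟩

lemma card_sub_one_le_of_isModular
    (hslope : ∀ S : Finset (ℝ × ℝ), 3 ≤ S.card → ¬ Collinear ℝ (S : Set (ℝ × ℝ)) →
      S.card - 1 ≤ {s : Option ℝ | ∃ p ∈ S, ∃ q ∈ S, p ≠ q ∧ s = slopeOf p q}.ncard)
    (hA : IsLineArr A) (hP : IsModular A P) : A.card - 1 ≤ 2 * maxMult A := by
  have hv : (![0, 0, 1] : Fin 3 → ℝ) ≠ 0 := fun h => by simpa using congrFun h 2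
  obtain ⟨e, he⟩ := SeparatingDual.exists_continuousLinearEquiv_apply_eq (R := ℝ) P.rep_nonzero hv
  replace he : e.toLinearEquiv P.rep = ![0, 0, 1] := he
  generalize e.toLinearEquiv = e at he
  obtain ⟨S, hS⟩ := exists_image_dualLine_eq hA he
  have hmem {p : ℝ × ℝ} (hp : p ∈ S) : dualLine e (affineCoords p) ∈ A :=
    (Finset.mem_filter.1 (hS ▸ Finset.mem_image_of_mem _ hp)).1
  have hcard : multAt A P + S.card = A.card := by
    rw [← Finset.card_image_of_injective S (dualLine_affineCoords_injective (e := e)), hS]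
    exact Finset.card_filter_add_card_filter_not _
  have hPmax := multAt_le_maxMult hP.1
  have hP₂ : 2 ≤ multAt A P := hP.1
  obtain hS₁ | hS₁ := Nat.lt_or_ge S.card 2
  · omega
  by_cases hcol : Collinear ℝ (S : Set (ℝ × ℝ))
  · obtain ⟨y, hy, h⟩ := (collinear_iff_exists_equation _).1 hcol
    have hy' : e.symm y ≠ 0 := by simpa using hy
    have hQ : S.card ≤ multAt A (Projectivization.mk ℝ _ hy') := by
      refine Finset.card_le_card_of_injOn (fun p => dualLine e (affineCoords p)) (fun p hp => ?_)
        dualLine_affineCoords_injective.injOn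
      refine Finset.mem_filter.2 ⟨hmem hp, ?_⟩
      rw [Projectivization.mk_submodule_le_iff, symm_mem_dualLine]
      simpa [affineCoords] using h p hp
    have := multAt_le_maxMult (hS₁.trans hQ)
    omega
  · have hS₃ : 3 ≤ S.card := by
      by_contra! h
      obtain ⟨p, q, -, rfl⟩ := Finset.card_eq_two.1 (show S.card = 2 by omega)
      exact hcol (by simpa using collinear_pair ℝ p q)
    have hle : {s : Option ℝ | ∃ p ∈ S, ∃ q ∈ S, p ≠ q ∧ s = slopeOf p q}.ncard ≤ multAt A P := by
      rw [multAt, ← Set.ncard_coe_finset]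
      refine Set.ncard_le_ncard_of_injOn (fun s => dualLine e (slopeCoords s)) ?_
        dualLine_slopeCoords_injective.injOn (Finset.finite_toSet _)
      rintro _ ⟨p, hp, q, hq, hpq, rfl⟩
      exact dualLine_slopeOf_mem_of_isModular hP he hpq (hmem hp) (hmem hq)
    have := hslope S hS₃ hcol
    omega

end SlopesToSupersolvable

/-- The Slope problem (any `n ≥ 3` non-collinear points of `ℝ²` determine at
least `n − 1` distinct slopes) is equivalent to: every full rank real supersolvable line
arrangement `A` satisfies `m(A) ≥ (|A| − 1)/2`. -/
theorem slope_problem_iff_supersolvable_bound :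
    (∀ S : Finset (ℝ × ℝ), 3 ≤ S.card → ¬ Collinear ℝ (S : Set (ℝ × ℝ)) →
      S.card - 1 ≤ {s : Option ℝ | ∃ p ∈ S, ∃ q ∈ S, p ≠ q ∧ s = slopeOf p q}.ncard) ↔
    (∀ A : Arr ℝ, IsLineArr A → FullRank A → Supersolvable A →
      A.card - 1 ≤ 2 * maxMult A) := by
  refine ⟨fun hslope A hA _ ⟨P, hP⟩ => card_sub_one_le_of_isModular hslope hA hP,
    fun hbound S hcard hS => ?_⟩
  have hslopes : {s : Option ℝ | ∃ p ∈ S, ∃ q ∈ S, p ≠ q ∧ s = slopeOf p q} =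
      (S.offDiag.image fun r => slopeOf r.1 r.2 : Finset (Option ℝ)) := by
    ext s
    simp only [Set.mem_ofPred_eq, Finset.coe_image, Set.mem_image, Finset.mem_coe,
      Finset.mem_offDiag, Prod.exists]
    grind
  rw [hslopes, Set.ncard_coe_finset]
  have h := hbound _ (isLineArr_slopeArr S) (fullRank_slopeArr hS)
    (supersolvable_slopeArr (by omega) hS)
  rw [card_slopeArr] at h
  have := maxMult_le (multAt_slopeArr_le hS)
  omega
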